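/- The limit as n tends to infinity of b(n,0)/(n * E(n)) exists and equals 1 - 2/pi; in other words, for large n, the probability that a vertex chosen uniformly at random from all n * E(n) vertices of all non-plane 1-2 trees on [n] is a leaf tends to 1 - 2/pi. -/

import Mathlib

namespace BalancedTrees

/-- Plane binary trees with vertices labeled by natural numbers;
`nil` is the empty tree, and each child of a vertex is designated
as a left child or a right child. -/
inductive BT where
  | nil : BT
  | node (label : ℕ) (l r : BT) : BT
deriving DecidableEq

namespace BT

/-- `balRank t = some k` if and only if the root of `t` is a balanced vertex of
rank `k`, i.e. every descending path from the root to a leaf has length `k`. -/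
def balRank : BT → Option ℕ
  | .nil => none
  | .node _ .nil .nil => some 0
  | .node _ .nil (.node b rl rr) => (balRank (BT.node b rl rr)).map (· + 1)
  | .node _ (.node a ll lr) .nil => (balRank (BT.node a ll lr)).map (· + 1)
  | .node _ (.node a ll lr) (.node b rl rr) =>
      match balRank (BT.node a ll lr), balRank (BT.node b rl rr) with
      | some i, some j => if i = j then some (i + 1) else none
      | _, _ => none

/-- The number of balanced vertices of rank `k` in the tree `t`. -/
def countBal (k : ℕ) : BT → ℕ
  | .nil => 0
  | .node v l r =>
      countBal k l + countBal k r +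
        (if balRank (BT.node v l r) = some k then 1 else 0)

/-- The number of balanced vertices (of any rank) in the tree `t`. -/
def countBalAll : BT → ℕ
  | .nil => 0
  | .node v l r =>
      countBalAll l + countBalAll r +
        (if (balRank (BT.node v l r)).isSome then 1 else 0)

/-- Auxiliary, fuelled version of `treeOf`. -/
def treeOfAux : ℕ → List ℕ → BT
  | 0, _ => .nil
  | _ + 1, [] => .nil
  | fuel + 1, l =>
      let m := l.foldr max 0
      BT.node m (treeOfAux fuel (l.takeWhile (· != m)))
                (treeOfAux fuel ((l.dropWhile (· != m)).tail))

/-- The decreasing binary tree `T(π)` of a sequence `π` of distinct labels: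
the root is the maximum entry, and its left (resp. right) subtree is built
recursively from the part of the sequence to the left (resp. right) of the
maximum. This is a bijection between permutations of `{1,…,n}` and
decreasing binary trees on `{1,…,n}`. -/
def treeOf (l : List ℕ) : BT := treeOfAux l.length l

/-- Canonical form for non-plane 1-2 trees (as represented by plane trees):
an only child is stored as a left child, and of two (unordered) children the
one with the larger label is stored on the left. Decreasing binary trees in
canonical form are in bijection with non-plane 1-2 trees. -/
def canonNP : BT → Bool
  | .nil => true
  | .node _ l r =>
      canonNP l && canonNP r &&
        (match l, r with
         | .nil, .nil => true
         | .node _ _ _, .nil => true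
         | .nil, .node _ _ _ => false
         | .node a _ _, .node b _ _ => decide (b < a))

/-- Canonical form for plane 1-2 trees: an only child is stored as a left
child (an only child carries no left/right designation), while two children
remain ordered. Decreasing binary trees in canonical form are in bijection
with plane 1-2 trees. -/
def canonP : BT → Bool
  | .nil => true
  | .node _ l r =>
      canonP l && canonP r &&
        (match l, r with
         | .nil, .node _ _ _ => false
         | _, _ => true)

end BT

open BT

/-- The list of all permutations of `{1,…,n}`, each written as a list. -/
def perms (n : ℕ) : List (List ℕ) := (List.range' 1 n).permutations

/-- `a n k`: the total number of balanced vertices of rank `k` over all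
decreasing binary trees on `{1,…,n}`. -/
def a (n k : ℕ) : ℕ := ((perms n).map fun l => countBal k (treeOf l)).sum

/-- `r n k`: the number of decreasing binary trees on `{1,…,n}` whose root is
balanced of rank `k`. -/
def r (n k : ℕ) : ℕ :=
  ((perms n).filter fun l => decide (balRank (treeOf l) = some k)).length

/-- `p n k`: the probability that the root of a uniformly random decreasing
binary tree on `{1,…,n}` is balanced of rank `k`; by convention `p 0 k = 1`. -/
def p (n k : ℕ) : ℚ := if n = 0 then 1 else (r n k : ℚ) / (Nat.factorial n : ℚ)

/-- The number of decreasing binary trees on `{1,…,n}` whose root is balanced. -/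
def rootBal (n : ℕ) : ℕ :=
  ((perms n).filter fun l => (balRank (treeOf l)).isSome).length

/-- `proot n`: the probability that the root of a uniformly random decreasing
binary tree on `{1,…,n}` is balanced. -/
def proot (n : ℕ) : ℚ := (rootBal n : ℚ) / (Nat.factorial n : ℚ)

/-- The total number of balanced vertices over all decreasing binary trees
on `{1,…,n}`. -/
def totalBal (n : ℕ) : ℕ := ((perms n).map fun l => countBalAll (treeOf l)).sum

/-- `Pbal n`: the probability that a vertex chosen uniformly at random from
the `n * n!` vertices of all decreasing binary trees on `{1,…,n}` is balanced. -/
def Pbal (n : ℕ) : ℚ := (totalBal n : ℚ) / ((n : ℚ) * (Nat.factorial n : ℚ))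

/-- Permutations whose decreasing binary tree is a canonical representative
of a non-plane 1-2 tree; these are in bijection with non-plane 1-2 trees
on `{1,…,n}`. -/
def npPerms (n : ℕ) : List (List ℕ) := (perms n).filter fun l => canonNP (treeOf l)

/-- `E n`: the number of non-plane 1-2 trees on `{1,…,n}` (the Euler number). -/
def E (n : ℕ) : ℕ := (npPerms n).length

/-- `b n k`: the total number of balanced vertices of rank `k` over all
non-plane 1-2 trees on `{1,…,n}`. -/
def b (n k : ℕ) : ℕ := ((npPerms n).map fun l => countBal k (treeOf l)).sum

/-- `s n k`: the number of non-plane 1-2 trees on `{1,…,n}` whose root is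
balanced of rank `k`. -/
def s (n k : ℕ) : ℕ :=
  ((npPerms n).filter fun l => decide (balRank (treeOf l) = some k)).length

/-- Permutations whose decreasing binary tree is a canonical representative
of a plane 1-2 tree; these are in bijection with plane 1-2 trees on `{1,…,n}`. -/
def pPerms (n : ℕ) : List (List ℕ) := (perms n).filter fun l => canonP (treeOf l)

/-- `z n`: the number of plane 1-2 trees on `{1,…,n}`. -/
def z (n : ℕ) : ℕ := (pPerms n).length

/-- `d n k`: the total number of balanced vertices of rank `k` over all
plane 1-2 trees on `{1,…,n}`. -/
def d (n k : ℕ) : ℕ := ((pPerms n).map fun l => countBal k (treeOf l)).sum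

/-- `t n k`: the number of plane 1-2 trees on `{1,…,n}` whose root is
balanced of rank `k`. -/
def t (n k : ℕ) : ℕ :=
  ((pPerms n).filter fun l => decide (balRank (treeOf l) = some k)).length

end BalancedTrees

open BalancedTrees

namespace BalancedTrees

open BT

lemma foldr_max_mem {l : List ℕ} (hl : l ≠ []) : l.foldr max 0 ∈ l := by
  induction l with
  | nil => exact absurd rfl hl
  | cons x l ih =>
    rcases eq_or_ne l [] with rfl | h
    · simp
    · rcases max_choice x (l.foldr max 0) with h' | h'
      · simp [h']
      · simpa [h'] using Or.inr (ih h)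

lemma foldr_max_eq {l : List ℕ} {m : ℕ} (hm : m ∈ l) (hle : ∀ x ∈ l, x ≤ m) :
    l.foldr max 0 = m := by
  refine le_antisymm (hle _ (foldr_max_mem (List.ne_nil_of_mem hm))) ?_
  clear hle
  induction l with
  | nil => simp at hm
  | cons x l ih =>
    rcases List.mem_cons.1 hm with rfl | h
    · simp
    · exact (ih h).trans (by simp)

lemma length_takeWhile_ne_lt {l : List ℕ} {m : ℕ} (hm : m ∈ l) :
    (l.takeWhile (· != m)).length < l.length := by
  refine lt_of_le_of_ne (List.takeWhile_sublist _).length_le fun h => ?_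
  have := (List.takeWhile_sublist (l := l) (· != m)).eq_of_length h
  rw [List.takeWhile_eq_self_iff] at this
  simpa using this m hm

lemma treeOfAux_eq_of_length_le (k : ℕ) :
    ∀ (j : ℕ) (l : List ℕ), l.length ≤ k → l.length ≤ j → treeOfAux k l = treeOfAux j l := by
  induction k with
  | zero =>
    intro j l hk _
    obtain rfl : l = [] := by simpa using hk
    cases j <;> rfl
  | succ k ih =>
    intro j l hk hj
    cases l with
    | nil => cases j <;> rfl
    | cons x l =>
      obtain ⟨j, rfl⟩ : ∃ i, j = i + 1 := ⟨j - 1, by simp at hj; omega⟩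
      have h1 := length_takeWhile_ne_lt (foldr_max_mem (List.cons_ne_nil x l))
      have h2 := (List.dropWhile_suffix (l := x :: l)
        (· != (x :: l).foldr max 0)).length_le
      simp only [treeOfAux]
      congr 1
      · exact ih _ _ (by omega) (by omega)
      · exact ih _ _ (by rw [List.length_tail]; omega) (by rw [List.length_tail]; omega)

lemma takeWhile_ne_append_cons {l₁ l₂ : List ℕ} {m : ℕ} (h₁ : m ∉ l₁) :
    (l₁ ++ m :: l₂).takeWhile (· != m) = l₁ := by
  rw [List.takeWhile_append_of_pos (by intro x hx; simpa using ne_of_mem_of_not_mem hx h₁)]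
  simp

lemma dropWhile_ne_append_cons {l₁ l₂ : List ℕ} {m : ℕ} (h₁ : m ∉ l₁) :
    (l₁ ++ m :: l₂).dropWhile (· != m) = m :: l₂ := by
  rw [List.dropWhile_append_of_pos (by intro x hx; simpa using ne_of_mem_of_not_mem hx h₁)]
  simp

lemma treeOf_append_cons {l₁ l₂ : List ℕ} {m : ℕ} (h₁ : ∀ x ∈ l₁, x < m)
    (h₂ : ∀ x ∈ l₂, x < m) :
    treeOf (l₁ ++ m :: l₂) = BT.node m (treeOf l₁) (treeOf l₂) := by
  have hm : m ∉ l₁ := fun h => (h₁ m h).false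
  have hmax : (l₁ ++ m :: l₂).foldr max 0 = m := foldr_max_eq (by simp) (by
    intro x hx
    simp only [List.mem_append, List.mem_cons] at hx
    rcases hx with h | rfl | h
    · exact (h₁ x h).le
    · exact le_rfl
    · exact (h₂ x h).le)
  have hlen : (l₁ ++ m :: l₂).length = (l₁.length + l₂.length) + 1 := by simp; omega
  have key : ∀ (k : ℕ) (l : List ℕ), l ≠ [] → treeOfAux (k + 1) l =
      BT.node (l.foldr max 0) (treeOfAux k (l.takeWhile (· != l.foldr max 0)))
        (treeOfAux k ((l.dropWhile (· != l.foldr max 0)).tail)) := by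
    intro k l hl
    cases l with
    | nil => exact absurd rfl hl
    | cons x l => rfl
  rw [treeOf, hlen, key _ _ (by simp), hmax, takeWhile_ne_append_cons hm,
    dropWhile_ne_append_cons hm, List.tail_cons]
  congr 1
  · exact treeOfAux_eq_of_length_le _ _ _ (by omega) le_rfl
  · exact treeOfAux_eq_of_length_le _ _ _ (by omega) le_rfl

lemma treeOf_nil : treeOf [] = BT.nil := rfl

lemma exists_treeOf_eq_node {l : List ℕ} (hl : l ≠ []) :
    ∃ t₁ t₂, treeOf l = BT.node (l.foldr max 0) t₁ t₂ := by
  cases l with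
  | nil => exact absurd rfl hl
  | cons x l => exact ⟨_, _, rfl⟩

/-- In a canonical tree with at least two vertices, the second largest label sits in the
left subtree. -/
lemma canonNP_append_cons {l₁ l₂ : List ℕ} {m m' : ℕ} (h₁ : ∀ x ∈ l₁, x ≤ m')
    (h₂ : ∀ x ∈ l₂, x ≤ m') (hm : m' < m) (hmem : m' ∈ l₁ ∨ m' ∈ l₂)
    (hdisj : l₁.Disjoint l₂) :
    canonNP (treeOf (l₁ ++ m :: l₂)) = true ↔
      canonNP (treeOf l₁) = true ∧ canonNP (treeOf l₂) = true ∧ m' ∈ l₁ := by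
  rw [treeOf_append_cons (fun x hx => (h₁ x hx).trans_lt hm)
    (fun x hx => (h₂ x hx).trans_lt hm)]
  rcases eq_or_ne l₁ [] with rfl | n₁
  · obtain ⟨t₁, t₂, h⟩ := exists_treeOf_eq_node
      (List.ne_nil_of_mem (hmem.resolve_left (by simp)))
    simp [h, treeOf_nil, canonNP]
  · obtain ⟨t₁, t₂, e₁⟩ := exists_treeOf_eq_node n₁
    rcases eq_or_ne l₂ [] with rfl | n₂
    · have : m' ∈ l₁ := hmem.resolve_right (by simp)
      simp [e₁, treeOf_nil, canonNP, this]
    · obtain ⟨s₁, s₂, e₂⟩ := exists_treeOf_eq_node n₂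
      have hlt : l₂.foldr max 0 < l₁.foldr max 0 ↔ m' ∈ l₁ := by
        constructor
        · intro hlt
          refine hmem.resolve_right fun h => ?_
          rw [foldr_max_eq h h₂] at hlt
          exact absurd (h₁ _ (foldr_max_mem n₁)) (by omega)
        · intro h
          rw [foldr_max_eq h h₁]
          exact lt_of_le_of_ne (h₂ _ (foldr_max_mem n₂))
            fun h' => hdisj h (h' ▸ foldr_max_mem n₂)
      rw [e₁, e₂, canonNP, ← e₁, ← e₂]
      simp [hlt, and_assoc]

lemma balRank_eq_some_zero_iff (v : ℕ) (t₁ t₂ : BT) :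
    balRank (BT.node v t₁ t₂) = some 0 ↔ t₁ = BT.nil ∧ t₂ = BT.nil := by
  cases t₁ <;> cases t₂ <;> simp only [balRank, Option.map_eq_some_iff] <;> try simp
  split <;> simp

lemma countBal_zero_append_cons {l₁ l₂ : List ℕ} {m : ℕ} (h₁ : ∀ x ∈ l₁, x < m)
    (h₂ : ∀ x ∈ l₂, x < m) (hl : l₁ ≠ []) :
    countBal 0 (treeOf (l₁ ++ m :: l₂)) = countBal 0 (treeOf l₁) + countBal 0 (treeOf l₂) := by
  obtain ⟨t₁, t₂, e⟩ := exists_treeOf_eq_node hl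
  rw [treeOf_append_cons h₁ h₂, countBal, if_neg, add_zero]
  simp [balRank_eq_some_zero_iff, e]

/-- The arrangements of a finite set of labels whose tree is canonical. -/
def arrangements (S : Finset ℕ) : Finset (List ℕ) :=
  S.val.lists.toFinset.filter fun l => canonNP (treeOf l) = true

lemma mem_arrangements {S : Finset ℕ} {l : List ℕ} :
    l ∈ arrangements S ↔ (l.Nodup ∧ l.toFinset = S) ∧ canonNP (treeOf l) = true := by
  rw [arrangements, Finset.mem_filter, Multiset.mem_toFinset, Multiset.mem_lists_iff]
  refine and_congr_left fun _ => ⟨fun h => ?_, ?_⟩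
  · have hn : l.Nodup := by
      have := S.nodup
      rwa [h, Multiset.quot_mk_to_coe, Multiset.coe_nodup] at this
    exact ⟨hn, Finset.val_injective (by rw [h, List.toFinset_val, hn.dedup]; rfl)⟩
  · rintro ⟨hn, rfl⟩
    rw [List.toFinset_val, hn.dedup]; rfl

lemma arrangements_empty : arrangements ∅ = {[]} := by
  ext l
  simp only [mem_arrangements, List.toFinset_eq_empty_iff, Finset.mem_singleton]
  constructor
  · exact fun h => h.1.2
  · rintro rfl
    simp [treeOf_nil, canonNP]

lemma arrangements_singleton (m : ℕ) : arrangements {m} = {[m]} := by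
  ext l
  simp only [mem_arrangements, Finset.mem_singleton]
  constructor
  · rintro ⟨⟨hn, h⟩, -⟩
    have := List.toFinset_card_of_nodup hn
    rw [h, Finset.card_singleton] at this
    obtain ⟨x, rfl⟩ := List.length_eq_one_iff.1 this.symm
    simpa using h
  · rintro rfl
    have := treeOf_append_cons (l₁ := []) (l₂ := []) (m := m) (by simp) (by simp)
    simp only [List.nil_append] at this
    simp [this, treeOf_nil, canonNP]

/-- A canonical tree with at least two vertices is determined by its right subtree, whose labels
avoid the two largest ones, and its left subtree, which carries the remaining labels. -/
lemma sum_arrangements_insert_insert {M : Type*} [AddCommMonoid M] {R : Finset ℕ} {m m' : ℕ}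
    (hR : ∀ x ∈ R, x < m') (hm : m' < m) (F : List ℕ → M) :
    ∑ l ∈ arrangements (insert m (insert m' R)), F l =
      ∑ U ∈ R.powerset, ∑ q ∈ arrangements U ×ˢ arrangements (insert m' (R \ U)),
        F (q.2 ++ m :: q.1) := by
  rw [Finset.sum_sigma']
  have hm'R : m' ∉ R := fun h => (hR _ h).false
  have hmR : m ∉ R := fun h => absurd (hR _ h) (by omega)
  refine Finset.sum_bij' (fun l _ => ⟨((l.dropWhile (· != m)).tail).toFinset,
      (l.dropWhile (· != m)).tail, l.takeWhile (· != m)⟩)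
    (fun p _ => p.2.2 ++ m :: p.2.1) ?_ ?_ ?_ ?_ ?_
  · intro l hl
    obtain ⟨⟨hn, hS⟩, hc⟩ := mem_arrangements.1 hl
    have hml : m ∈ l := by rw [← List.mem_toFinset, hS]; simp
    obtain ⟨l₁, l₂, rfl⟩ := List.append_of_mem hml
    have hmem : ∀ x, x ∈ l₁ ++ m :: l₂ ↔ x = m ∨ x = m' ∨ x ∈ R := by
      intro x
      rw [← List.mem_toFinset, hS]; simp
    obtain ⟨n₁, n₂, hd⟩ := List.nodup_append.1 hn
    obtain ⟨n₃, n₂⟩ := List.nodup_cons.1 n₂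
    have hm₁ : m ∉ l₁ := fun h => hd m h m (by simp) rfl
    have hdisj : l₁.Disjoint l₂ := fun x h h' => hd x h x (by simp [h']) rfl
    have b₁ : ∀ x ∈ l₁, x = m' ∨ x ∈ R := fun x hx =>
      ((hmem x).1 (by simp [hx])).resolve_left (by rintro rfl; exact hm₁ hx)
    have b₂ : ∀ x ∈ l₂, x = m' ∨ x ∈ R := fun x hx =>
      ((hmem x).1 (by simp [hx])).resolve_left (by rintro rfl; exact n₃ hx)
    rw [canonNP_append_cons (m' := m')
      (fun x hx => (b₁ x hx).elim (fun h => h.le) fun h => (hR x h).le)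
      (fun x hx => (b₂ x hx).elim (fun h => h.le) fun h => (hR x h).le) hm
      (by have := (hmem m').2 (by simp)
          simpa [hm.ne] using this) hdisj] at hc
    simp only [takeWhile_ne_append_cons hm₁, dropWhile_ne_append_cons hm₁, List.tail_cons,
      Finset.mem_sigma, Finset.mem_powerset, Finset.mem_product, mem_arrangements]
    refine ⟨?_, ⟨⟨n₂, trivial⟩, hc.2.1⟩, ⟨n₁, ?_⟩, hc.1⟩
    · intro x hx
      rw [List.mem_toFinset] at hx
      exact (b₂ x hx).resolve_left (by rintro rfl; exact hdisj hc.2.2 hx)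
    · ext x
      simp only [List.mem_toFinset, Finset.mem_insert, Finset.mem_sdiff]
      constructor
      · exact fun hx => (b₁ x hx).imp id fun h => ⟨h, fun h' => hdisj hx h'⟩
      · rintro (rfl | ⟨h, h'⟩)
        · exact hc.2.2
        · have := (hmem x).2 (by simp [h])
          have hxm : x ≠ m := by rintro rfl; exact hmR h
          simpa [hxm, h'] using this
  · rintro ⟨U, l₂, l₁⟩ hp
    simp only [Finset.mem_sigma, Finset.mem_powerset, Finset.mem_product, mem_arrangements] at hp
    obtain ⟨hU, ⟨⟨n₂, rfl⟩, c₂⟩, ⟨n₁, s₁⟩, c₁⟩ := hp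
    have b₁ : ∀ x, x ∈ l₁ ↔ x = m' ∨ x ∈ R ∧ x ∉ l₂ := by
      intro x; rw [← List.mem_toFinset, s₁]; simp
    have b₂ : ∀ x ∈ l₂, x ∈ R := fun x hx => hU (by simpa using hx)
    have hdisj : l₁.Disjoint l₂ := by
      intro x hx hx'
      rcases (b₁ x).1 hx with rfl | h
      · exact hm'R (b₂ _ hx')
      · exact h.2 hx'
    have hm₁ : m ∉ l₁ := by
      rw [b₁]; rintro (h | h)
      · omega
      · exact hmR h.1
    have hm₂ : m ∉ l₂ := fun h => hmR (b₂ _ h)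
    rw [mem_arrangements, canonNP_append_cons (m' := m')
      (fun x hx => ((b₁ x).1 hx).elim (fun h => h.le) fun h => (hR x h.1).le)
      (fun x hx => (hR x (b₂ x hx)).le) hm (Or.inl ((b₁ m').2 (Or.inl rfl))) hdisj]
    refine ⟨⟨?_, ?_⟩, c₁, c₂, (b₁ m').2 (Or.inl rfl)⟩
    · refine List.nodup_append.2 ⟨n₁, List.nodup_cons.2 ⟨hm₂, n₂⟩, ?_⟩
      rintro x hx y hy rfl
      rcases List.mem_cons.1 hy with rfl | hy
      · exact hm₁ hx
      · exact hdisj hx hy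
    · ext x
      have := b₂ x
      simp only [List.mem_toFinset, List.mem_append, List.mem_cons, Finset.mem_insert, b₁]
      tauto
  · intro l hl
    obtain ⟨⟨hn, hS⟩, hc⟩ := mem_arrangements.1 hl
    have hml : m ∈ l := by rw [← List.mem_toFinset, hS]; simp
    obtain ⟨l₁, l₂, rfl⟩ := List.append_of_mem hml
    have hm₁ : m ∉ l₁ := fun h => (List.nodup_append.1 hn).2.2 m h m (by simp) rfl
    simp [takeWhile_ne_append_cons hm₁, dropWhile_ne_append_cons hm₁]
  · rintro ⟨U, l₂, l₁⟩ hp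
    simp only [Finset.mem_sigma, Finset.mem_powerset, Finset.mem_product, mem_arrangements] at hp
    obtain ⟨hU, ⟨⟨n₂, rfl⟩, c₂⟩, ⟨n₁, s₁⟩, c₁⟩ := hp
    have hm₁ : m ∉ l₁ := by
      rw [← List.mem_toFinset, s₁]; simp [hm.ne', hmR]
    simp only [takeWhile_ne_append_cons hm₁, dropWhile_ne_append_cons hm₁, List.tail_cons]
  · intro l hl
    obtain ⟨⟨hn, hS⟩, hc⟩ := mem_arrangements.1 hl
    have hml : m ∈ l := by rw [← List.mem_toFinset, hS]; simp
    obtain ⟨l₁, l₂, rfl⟩ := List.append_of_mem hml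
    have hm₁ : m ∉ l₁ := fun h => (List.nodup_append.1 hn).2.2 m h m (by simp) rfl
    simp [takeWhile_ne_append_cons hm₁, dropWhile_ne_append_cons hm₁]

/-- The Euler numbers, through the recurrence that removes the largest label of a non-plane
1-2 tree. -/
def eulerNumber : ℕ → ℕ
  | 0 => 1
  | 1 => 1
  | n + 2 => ∑ k : Fin (n + 1), n.choose k * eulerNumber k * eulerNumber (n + 1 - k)

lemma eulerNumber_add_two (n : ℕ) : eulerNumber (n + 2) =
    ∑ k ∈ Finset.range (n + 1), n.choose k * (eulerNumber k * eulerNumber (n + 1 - k)) := by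
  simp only [eulerNumber, Finset.sum_range, mul_assoc]

lemma eulerNumber_add_two_eq_sum_antidiagonal (n : ℕ) : eulerNumber (n + 2) =
    ∑ p ∈ Finset.HasAntidiagonal.antidiagonal n,
      n.choose p.1 * (eulerNumber p.1 * eulerNumber (p.2 + 1)) := by
  rw [eulerNumber_add_two, Finset.Nat.sum_antidiagonal_eq_sum_range_succ_mk]
  refine Finset.sum_congr rfl fun k hk => ?_
  rw [Finset.mem_range] at hk
  rw [Nat.sub_add_comm (by omega)]

/-- The total number of leaves of the canonical trees on `n` labels, as an integer. -/
def leafNumber (n : ℕ) : ℤ := (n + 1) * eulerNumber n - eulerNumber (n + 1)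

lemma leafNumber_add_two (n : ℕ) : leafNumber (n + 2) =
    ∑ k ∈ Finset.range (n + 1), n.choose k * (leafNumber k * eulerNumber (n + 1 - k) +
      eulerNumber k * leafNumber (n + 1 - k)) := by
  have h3 := Finset.sum_antidiagonal_choose_succ_mul
    (fun i j => eulerNumber i * eulerNumber (j + 1)) n
  simp only [Nat.cast_id] at h3
  rw [← eulerNumber_add_two_eq_sum_antidiagonal (n + 1)] at h3
  have hr := (Finset.Nat.sum_antidiagonal_eq_sum_range_succ (fun i j => (n.choose i : ℤ) *
    (leafNumber i * eulerNumber (j + 1) + eulerNumber i * leafNumber (j + 1))) n)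
  have hr' : ∑ k ∈ Finset.range (n + 1), (n.choose k : ℤ) *
      (leafNumber k * eulerNumber (n + 1 - k) + eulerNumber k * leafNumber (n + 1 - k)) =
      ∑ k ∈ Finset.range n.succ, (n.choose k : ℤ) *
      (leafNumber k * eulerNumber (n - k + 1) + eulerNumber k * leafNumber (n - k + 1)) := by
    refine Finset.sum_congr rfl fun k hk => ?_
    rw [Finset.mem_range] at hk
    rw [Nat.sub_add_comm (by omega)]
  rw [hr', ← hr, leafNumber, show n + 2 + 1 = n + 1 + 2 by rfl, h3,
    eulerNumber_add_two_eq_sum_antidiagonal n]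
  push_cast
  rw [Finset.mul_sum, ← Finset.sum_add_distrib, ← Finset.sum_sub_distrib]
  refine Finset.sum_congr rfl fun p hp => ?_
  have hn : (n : ℤ) = p.1 + p.2 := by exact_mod_cast (Finset.HasAntidiagonal.mem_antidiagonal.1 hp).symm
  have hc : n.choose p.2 = n.choose p.1 :=
    (Nat.choose_symm_of_eq_add (Finset.HasAntidiagonal.mem_antidiagonal.1 hp).symm).symm
  rw [hc, hn, leafNumber, leafNumber]
  push_cast
  ring

lemma exists_eq_insert_insert {S : Finset ℕ} {n : ℕ} (hS : S.card = n + 2) :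
    ∃ (R : Finset ℕ) (m m' : ℕ), S = insert m (insert m' R) ∧ (∀ x ∈ R, x < m') ∧ m' < m ∧
      R.card = n := by
  have max_erase : ∀ {T : Finset ℕ} {k : ℕ}, T.card = k + 1 →
      ∃ m ∈ T, (∀ x ∈ T.erase m, x < m) ∧ (T.erase m).card = k := by
    intro T k hT
    have hne : T.Nonempty := Finset.card_pos.1 (by omega)
    refine ⟨T.max' hne, T.max'_mem hne, fun x hx => T.lt_max'_of_mem_erase_max' hne hx, ?_⟩
    rw [Finset.card_erase_of_mem (T.max'_mem hne), hT, Nat.add_sub_cancel]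
  obtain ⟨m, hm, hlt, hc⟩ := max_erase hS
  obtain ⟨m', hm', hlt', hc'⟩ := max_erase hc
  exact ⟨_, m, m', by rw [Finset.insert_erase hm', Finset.insert_erase hm], hlt', hlt _ hm', hc'⟩

lemma card_insert_sdiff {R U : Finset ℕ} {m' : ℕ} (hR : ∀ x ∈ R, x < m') (hU : U ⊆ R) :
    (insert m' (R \ U)).card = R.card + 1 - U.card := by
  rw [Finset.card_insert_of_notMem fun h => (hR _ (Finset.mem_sdiff.1 h).1).false,
    Finset.card_sdiff_of_subset hU, Nat.sub_add_comm (Finset.card_le_card hU)]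

theorem card_arrangements (S : Finset ℕ) : (arrangements S).card = eulerNumber S.card := by
  induction h : S.card using Nat.strong_induction_on generalizing S with
  | _ n ih =>
    match n, h with
    | 0, h =>
      rw [Finset.card_eq_zero.1 h, arrangements_empty, eulerNumber, Finset.card_singleton]
    | 1, h =>
      obtain ⟨m, rfl⟩ := Finset.card_eq_one.1 h
      rw [arrangements_singleton, eulerNumber, Finset.card_singleton]
    | n + 2, h =>
      obtain ⟨R, m, m', rfl, hR, hm, rfl⟩ := exists_eq_insert_insert h
      rw [Finset.card_eq_sum_ones, sum_arrangements_insert_insert hR hm, eulerNumber_add_two]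
      have hpow := Finset.sum_powerset_apply_card (x := R)
        (fun k => eulerNumber k * eulerNumber (R.card + 1 - k))
      simp only [smul_eq_mul] at hpow
      rw [← hpow]
      refine Finset.sum_congr rfl fun U hU => ?_
      rw [Finset.mem_powerset] at hU
      have hc := Finset.card_le_card hU
      rw [← Finset.card_eq_sum_ones, Finset.card_product, ih U.card (by omega) U rfl,
        ih _ (by omega) _ (card_insert_sdiff hR hU)]

theorem sum_countBal_zero_arrangements (S : Finset ℕ) :
    ∑ l ∈ arrangements S, (countBal 0 (treeOf l) : ℤ) = leafNumber S.card := by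
  induction h : S.card using Nat.strong_induction_on generalizing S with
  | _ n ih =>
    match n, h with
    | 0, h =>
      rw [Finset.card_eq_zero.1 h, arrangements_empty, Finset.sum_singleton, treeOf_nil]
      simp [countBal, leafNumber, eulerNumber]
    | 1, h =>
      obtain ⟨m, rfl⟩ := Finset.card_eq_one.1 h
      have := treeOf_append_cons (l₁ := []) (l₂ := []) (m := m) (by simp) (by simp)
      simp only [List.nil_append] at this
      rw [arrangements_singleton, Finset.sum_singleton, this]
      simp [treeOf_nil, countBal, leafNumber, eulerNumber, balRank]
    | n + 2, h =>
      obtain ⟨R, m, m', rfl, hR, hm, rfl⟩ := exists_eq_insert_insert h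
      rw [sum_arrangements_insert_insert hR hm, leafNumber_add_two]
      have hpow := Finset.sum_powerset_apply_card (x := R)
        (fun k => leafNumber k * eulerNumber (R.card + 1 - k) +
          eulerNumber k * leafNumber (R.card + 1 - k))
      simp only [nsmul_eq_mul] at hpow
      rw [← hpow]
      refine Finset.sum_congr rfl fun U hU => ?_
      rw [Finset.mem_powerset] at hU
      have hc := Finset.card_le_card hU
      have hcard := card_insert_sdiff hR hU
      have hsum : ∀ q ∈ arrangements U ×ˢ arrangements (insert m' (R \ U)),
          (countBal 0 (treeOf (q.2 ++ m :: q.1)) : ℤ) =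
            countBal 0 (treeOf q.1) + countBal 0 (treeOf q.2) := by
        rintro ⟨l₂, l₁⟩ hq
        simp only [Finset.mem_product, mem_arrangements] at hq
        obtain ⟨⟨⟨-, s₂⟩, -⟩, ⟨-, s₁⟩, -⟩ := hq
        have b₁ : ∀ x, x ∈ l₁ ↔ x = m' ∨ x ∈ R ∧ x ∉ U := by
          intro x; rw [← List.mem_toFinset, s₁]; simp
        rw [countBal_zero_append_cons, Nat.cast_add, add_comm]
        · exact fun x hx => ((b₁ x).1 hx).elim (fun h => h ▸ hm) fun h => (hR x h.1).trans hm
        · exact fun x hx => (hR x (hU (s₂ ▸ List.mem_toFinset.2 hx))).trans hm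
        · exact List.ne_nil_of_mem ((b₁ m').2 (Or.inl rfl))
      rw [Finset.sum_congr rfl hsum, Finset.sum_add_distrib, Finset.sum_product,
        Finset.sum_product_right]
      simp only [Finset.sum_const, ← Finset.smul_sum]
      rw [ih U.card (by omega) U rfl, ih _ (by omega) _ hcard, card_arrangements,
        card_arrangements, hcard, nsmul_eq_mul, nsmul_eq_mul, mul_comm (leafNumber _)]

lemma nodup_npPerms (n : ℕ) : (npPerms n).Nodup :=
  (List.nodup_permutations _ List.nodup_range').filter _

lemma toFinset_npPerms (n : ℕ) :
    (npPerms n).toFinset = arrangements (List.range' 1 n).toFinset := by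
  ext l
  rw [List.mem_toFinset, npPerms, perms, List.mem_filter, List.mem_permutations,
    mem_arrangements]
  refine and_congr_left fun _ => ⟨fun h => ⟨h.nodup_iff.2 List.nodup_range',
    List.toFinset_eq_of_perm _ _ h⟩, fun h => ?_⟩
  exact List.perm_of_nodup_nodup_toFinset_eq h.1 List.nodup_range' h.2

lemma card_toFinset_range' (n : ℕ) : (List.range' 1 n).toFinset.card = n := by
  rw [List.toFinset_card_of_nodup List.nodup_range', List.length_range']

theorem E_eq_eulerNumber (n : ℕ) : E n = eulerNumber n := by
  rw [E, ← List.toFinset_card_of_nodup (nodup_npPerms n), toFinset_npPerms, card_arrangements,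
    card_toFinset_range']

theorem b_zero_eq_leafNumber (n : ℕ) : (b n 0 : ℤ) = leafNumber n := by
  rw [b, ← List.sum_toFinset _ (nodup_npPerms n), toFinset_npPerms]
  push_cast
  rw [sum_countBal_zero_arrangements, card_toFinset_range']

/-- The function `z ↦ sec z + tan z`, the exponential generating function of the Euler numbers,
written as a cotangent. -/
noncomputable def secAddTan (z : ℂ) : ℂ :=
  Complex.cos (Real.pi / 4 - z / 2) / Complex.sin (Real.pi / 4 - z / 2)

lemma sin_ne_zero_of_eq_pi_div_four_sub {z : ℂ} (hz : ‖z‖ < 3 * Real.pi / 2)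
    (hw : (Real.pi / 4 - z / 2 : ℂ) ≠ 0) : Complex.sin (Real.pi / 4 - z / 2) ≠ 0 := by
  intro h
  obtain ⟨k, hk⟩ := Complex.sin_eq_zero_iff.1 h
  have hπ := Real.pi_pos
  have hz' : z = ((Real.pi / 2 - 2 * k * Real.pi : ℝ) : ℂ) := by
    push_cast
    linear_combination (-2) * hk
  rw [hz', Complex.norm_real, Real.norm_eq_abs, abs_lt] at hz
  have h1 : (k : ℝ) < 1 := by nlinarith
  have h2 : (-1 : ℝ) < k := by nlinarith
  have h1' : k < 1 := by exact_mod_cast h1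
  have h2' : -1 < k := by exact_mod_cast h2
  obtain rfl : k = 0 := by omega
  exact hw (by rw [hk]; simp)

lemma sin_pi_div_four_sub_ne_zero {z : ℂ} (hz : ‖z‖ < Real.pi / 2) :
    Complex.sin (Real.pi / 4 - z / 2) ≠ 0 := by
  have hπ := Real.pi_pos
  refine sin_ne_zero_of_eq_pi_div_four_sub (by linarith) fun h => ?_
  have hz' : z = ((Real.pi / 2 : ℝ) : ℂ) := by
    push_cast
    linear_combination (-2) * h
  rw [hz', Complex.norm_real, Real.norm_eq_abs, abs_of_pos (by positivity)] at hz
  exact hz.false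

lemma eventually_norm_lt {r : ℝ} (hr : 0 < r) : ∀ᶠ z : ℂ in nhds 0, ‖z‖ < r := by
  filter_upwards [Metric.ball_mem_nhds (0 : ℂ) hr] with z hz
  simpa using hz

lemma hasDerivAt_secAddTan {z : ℂ} (hz : ‖z‖ < Real.pi / 2) :
    HasDerivAt secAddTan ((secAddTan z ^ 2 + 1) / 2) z := by
  have hs := sin_pi_div_four_sub_ne_zero hz
  have hw : HasDerivAt (fun z : ℂ => (Real.pi / 4 - z / 2 : ℂ)) (-(1 / 2)) z :=
    ((hasDerivAt_id z).div_const 2).const_sub _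
  refine (hw.ccos.div hw.csin hs).congr_deriv ?_
  rw [secAddTan]
  set w : ℂ := Real.pi / 4 - z / 2
  field_simp
  ring

lemma deriv_secAddTan : deriv secAddTan =ᶠ[nhds 0] fun z => (secAddTan z ^ 2 + 1) / 2 :=
  (eventually_norm_lt (by positivity)).mono fun _ hz => (hasDerivAt_secAddTan hz).deriv

lemma deriv_deriv_secAddTan :
    deriv (deriv secAddTan) =ᶠ[nhds 0] secAddTan * deriv secAddTan := by
  filter_upwards [deriv_secAddTan.deriv, eventually_norm_lt (r := Real.pi / 2) (by positivity)]
    with z h hz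
  have hd := hasDerivAt_secAddTan hz
  rw [h, (((hd.fun_pow 2).add_const 1).div_const 2).deriv, Pi.mul_apply, hd.deriv]
  simp
  ring

lemma analyticAt_secAddTan : AnalyticAt ℂ secAddTan 0 := by
  have hs := sin_pi_div_four_sub_ne_zero (z := 0) (by simp; positivity)
  unfold secAddTan
  fun_prop (disch := exact hs)

lemma iteratedDeriv_secAddTan (n : ℕ) : iteratedDeriv n secAddTan 0 = eulerNumber n := by
  have h0 : secAddTan 0 = 1 := by
    have hs := sin_pi_div_four_sub_ne_zero (z := 0) (by simp; positivity)
    have hsc : Complex.cos (Real.pi / 4 - 0 / 2) = Complex.sin (Real.pi / 4 - 0 / 2) := by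
      rw [← Complex.sin_pi_div_two_sub]
      congr 1
      ring
    rw [secAddTan, hsc, div_self hs]
  induction n using Nat.strong_induction_on with
  | _ n ih =>
    match n with
    | 0 => simp [h0, eulerNumber]
    | 1 =>
      rw [iteratedDeriv_one, deriv_secAddTan.self_of_nhds]
      norm_num [h0, eulerNumber]
    | n + 2 =>
      have hG := analyticAt_secAddTan
      rw [iteratedDeriv_succ', iteratedDeriv_succ', deriv_deriv_secAddTan.iteratedDeriv_eq n,
        iteratedDeriv_mul hG.contDiffAt hG.deriv.contDiffAt, eulerNumber_add_two]
      push_cast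
      refine Finset.sum_congr rfl fun k hk => ?_
      rw [Finset.mem_range] at hk
      rw [← iteratedDeriv_succ', ih k (by omega), ih (n - k + 1) (by omega),
        Nat.sub_add_comm (by omega), mul_assoc]

/-- The function `(π / 2 - z) * secAddTan z` with its removable singularity at
`π / 2` filled in. -/
noncomputable def regularPart (z : ℂ) : ℂ :=
  2 * Complex.cos (Real.pi / 4 - z / 2) / dslope Complex.sin 0 (Real.pi / 4 - z / 2)

lemma regularPart_eq :
    regularPart =ᶠ[nhds 0] (fun z => (Real.pi / 2 - z : ℂ)) * secAddTan := by
  filter_upwards [eventually_norm_lt (r := Real.pi / 2) (by positivity)] with z hz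
  have hs := sin_pi_div_four_sub_ne_zero hz
  have hw : (Real.pi / 4 - z / 2 : ℂ) ≠ 0 := fun h => hs (by rw [h, Complex.sin_zero])
  rw [regularPart, dslope_of_ne _ hw, slope_def_field, Pi.mul_apply, secAddTan, Complex.sin_zero,
    sub_zero, sub_zero, div_div_eq_mul_div, mul_div_assoc']
  congr 1
  ring

lemma differentiableOn_regularPart :
    DifferentiableOn ℂ regularPart (Metric.ball 0 (3 * Real.pi / 2)) := by
  intro z hz
  rw [mem_ball_zero_iff] at hz
  have hd : Differentiable ℂ (dslope Complex.sin 0) := by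
    rw [← differentiableOn_univ, Complex.differentiableOn_dslope Filter.univ_mem]
    exact Complex.differentiable_sin.differentiableOn
  have hne : dslope Complex.sin 0 (Real.pi / 4 - z / 2) ≠ 0 := by
    by_cases hw : (Real.pi / 4 - z / 2 : ℂ) = 0
    · rw [hw, dslope_same, Complex.deriv_sin, Complex.cos_zero]
      exact one_ne_zero
    · rw [dslope_of_ne _ hw, slope_def_field, Complex.sin_zero, sub_zero, sub_zero]
      exact div_ne_zero (sin_ne_zero_of_eq_pi_div_four_sub hz hw) hw
  refine DifferentiableAt.differentiableWithinAt ?_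
  unfold regularPart
  refine DifferentiableAt.div (by fun_prop) ?_ hne
  exact (hd _).comp z (by fun_prop)

lemma iteratedDeriv_regularPart (n : ℕ) : iteratedDeriv (n + 1) regularPart 0 =
    Real.pi / 2 * eulerNumber (n + 1) - (n + 1) * eulerNumber n := by
  have hd : deriv (fun z : ℂ => (Real.pi / 2 - z : ℂ)) = fun _ => -1 := by
    ext z
    simp
  have hG := analyticAt_secAddTan
  rw [regularPart_eq.iteratedDeriv_eq, iteratedDeriv_mul (by fun_prop) hG.contDiffAt,
    Finset.sum_range_succ', Finset.sum_range_succ', Finset.sum_eq_zero]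
  · simp [iteratedDeriv_succ', hd, iteratedDeriv_secAddTan]
    ring
  · intro k _
    rw [iteratedDeriv_succ', hd, iteratedDeriv_const]
    simp

lemma exists_abs_sub_le : ∃ C : ℝ, ∀ n : ℕ,
    |Real.pi / 2 * eulerNumber (n + 1) - (n + 1) * eulerNumber n| ≤
      (n + 1).factorial * C / Real.pi ^ (n + 1) := by
  have hπ := Real.pi_pos
  have hsub : Metric.closedBall (0 : ℂ) Real.pi ⊆ Metric.ball 0 (3 * Real.pi / 2) :=
    Metric.closedBall_subset_ball (by linarith)
  have hdiff := differentiableOn_regularPart.mono hsub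
  obtain ⟨C, hC⟩ := (isCompact_closedBall (0 : ℂ) Real.pi).exists_bound_of_continuousOn
    hdiff.continuousOn
  refine ⟨C, fun n => ?_⟩
  have := Complex.norm_iteratedDeriv_le_of_forall_mem_sphere_norm_le (n + 1) hπ
    (hdiff.diffContOnCl_ball subset_rfl) fun z hz => hC z (Metric.sphere_subset_closedBall hz)
  rw [iteratedDeriv_regularPart] at this
  rw [← Real.norm_eq_abs, ← Complex.norm_real]
  simpa using this

lemma factorial_le_two_pow_mul_eulerNumber (n : ℕ) :
    n.factorial ≤ 2 ^ n * eulerNumber n := by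
  induction n using Nat.strong_induction_on with
  | _ n ih =>
    match n with
    | 0 => simp [eulerNumber]
    | 1 => simp [eulerNumber]
    | n + 2 =>
      have hterm : ∀ k ∈ Finset.range (n + 1), n.factorial * (n + 1 - k) ≤
          2 ^ (n + 1) * (n.choose k * (eulerNumber k * eulerNumber (n + 1 - k))) := by
        intro k hk
        rw [Finset.mem_range] at hk
        have h1 := ih k (by omega)
        have h2 := ih (n + 1 - k) (by omega)
        calc n.factorial * (n + 1 - k)
            = n.choose k * (k.factorial * (n + 1 - k).factorial) := by
              rw [← Nat.choose_mul_factorial_mul_factorial (show k ≤ n by omega),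
                Nat.sub_add_comm (show k ≤ n by omega), Nat.factorial_succ]
              ring
          _ ≤ n.choose k * ((2 ^ k * eulerNumber k) *
                (2 ^ (n + 1 - k) * eulerNumber (n + 1 - k))) := by gcongr
          _ = 2 ^ (k + (n + 1 - k)) *
                (n.choose k * (eulerNumber k * eulerNumber (n + 1 - k))) := by
              rw [pow_add]; ring
          _ = _ := by rw [Nat.add_sub_cancel' (by omega)]
      have hgauss : 2 * ∑ k ∈ Finset.range (n + 1), (n + 1 - k) = (n + 1) * (n + 2) := by
        have hflip : ∑ k ∈ Finset.range (n + 1), (n + 1 - k) =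
            ∑ k ∈ Finset.range (n + 1), (k + 1) := by
          rw [← Finset.sum_range_reflect]
          refine Finset.sum_congr rfl fun k hk => ?_
          rw [Finset.mem_range] at hk
          omega
        have := Finset.sum_range_succ' (fun k => k) (n + 1)
        rw [hflip, mul_comm, ← add_zero (∑ k ∈ Finset.range (n + 1), (k + 1)), ← this,
          Finset.sum_range_id_mul_two]
        simp [mul_comm]
      have hsum := Finset.sum_le_sum hterm
      rw [← Finset.mul_sum, ← Finset.mul_sum, ← eulerNumber_add_two] at hsum
      calc (n + 2).factorial = n.factorial * ((n + 1) * (n + 2)) := by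
            rw [Nat.factorial_succ, Nat.factorial_succ]; ring
        _ = 2 * (n.factorial * ∑ k ∈ Finset.range (n + 1), (n + 1 - k)) := by
            rw [← hgauss]; ring
        _ ≤ 2 * (2 ^ (n + 1) * eulerNumber (n + 2)) := by gcongr
        _ = _ := by rw [pow_succ 2 (n + 1)]; ring

lemma eulerNumber_pos (n : ℕ) : 0 < eulerNumber n :=
  Nat.pos_of_mul_pos_left ((Nat.factorial_pos n).trans_le (factorial_le_two_pow_mul_eulerNumber n))

theorem tendsto_eulerNumber_succ_div :
    Filter.Tendsto (fun n : ℕ => (eulerNumber (n + 1) : ℝ) / ((n + 1) * eulerNumber n))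
      Filter.atTop (nhds (2 / Real.pi)) := by
  obtain ⟨C, hC⟩ := exists_abs_sub_le
  have hπ := Real.pi_pos
  have hC0 : 0 ≤ C := by
    have := (abs_nonneg _).trans (hC 0)
    by_contra! hneg
    exact absurd this (not_le.2 (by simpa using div_neg_of_neg_of_pos hneg hπ))
  have hlim : Filter.Tendsto (fun n : ℕ => 2 * C / Real.pi ^ 2 * (2 / Real.pi) ^ n)
      Filter.atTop (nhds 0) := by
    have h1 : 2 / Real.pi < 1 := (div_lt_one hπ).2 (by linarith [Real.pi_gt_three])
    simpa using (tendsto_pow_atTop_nhds_zero_of_lt_one (by positivity) h1).const_mul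
      (2 * C / Real.pi ^ 2)
  refine tendsto_iff_norm_sub_tendsto_zero.2 (squeeze_zero (fun _ => norm_nonneg _) ?_ hlim)
  intro n
  have he : (0 : ℝ) < eulerNumber n := by exact_mod_cast eulerNumber_pos n
  have hfac : (n.factorial : ℝ) ≤ 2 ^ n * eulerNumber n := by
    exact_mod_cast factorial_le_two_pow_mul_eulerNumber n
  have hd : (0 : ℝ) < Real.pi / 2 * ((n + 1) * eulerNumber n) := by positivity
  have hrw : (eulerNumber (n + 1) : ℝ) / ((n + 1) * eulerNumber n) - 2 / Real.pi =
      (Real.pi / 2 * eulerNumber (n + 1) - (n + 1) * eulerNumber n) /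
        (Real.pi / 2 * ((n + 1) * eulerNumber n)) := by
    field_simp
  rw [hrw, Real.norm_eq_abs, abs_div, abs_of_pos hd, div_le_iff₀ hd]
  refine (hC n).trans ?_
  calc ((n + 1).factorial * C / Real.pi ^ (n + 1) : ℝ)
      = (n + 1) * C / Real.pi ^ (n + 1) * n.factorial := by
        rw [Nat.factorial_succ]; push_cast; ring
    _ ≤ (n + 1) * C / Real.pi ^ (n + 1) * (2 ^ n * eulerNumber n) := by gcongr
    _ = _ := by
        rw [div_pow, pow_succ]; field_simp

end BalancedTrees

/-- `lim_{n→∞} b(n,0)/(n·E(n))` exists and equals `1 - 2/π`: for large `n`,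
the probability that a uniformly random vertex of all non-plane 1-2 trees on
`{1,…,n}` is a leaf tends to `1 - 2/π`. -/
theorem statement11 :
    Filter.Tendsto (fun n : ℕ => (b n 0 : ℝ) / ((n : ℝ) * (E n : ℝ)))
      Filter.atTop (nhds (1 - 2 / Real.pi)) := by
  have hinv : Filter.Tendsto (fun n : ℕ => 1 + 1 / (n : ℝ)) Filter.atTop (nhds 1) := by
    simpa using tendsto_one_div_atTop_nhds_zero_nat.const_add (1 : ℝ)
  have hlim := hinv.mul (tendsto_eulerNumber_succ_div.const_sub 1)
  rw [one_mul] at hlim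
  refine hlim.congr' ?_
  filter_upwards [Filter.eventually_ne_atTop 0] with n hn
  have hb : (b n 0 : ℝ) = (n + 1) * eulerNumber n - eulerNumber (n + 1) := by
    rw [← Int.cast_natCast (b n 0), b_zero_eq_leafNumber, leafNumber]
    push_cast
    rfl
  have hn' : (n : ℝ) ≠ 0 := by exact_mod_cast hn
  have he : (eulerNumber n : ℝ) ≠ 0 := by exact_mod_cast (eulerNumber_pos n).ne'
  rw [hb, E_eq_eulerNumber]
  field_simp
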